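/- Gelfand spectral radius formula for the ℋ-algebra: for every f ∈ L¹(ℝⁿ), the sequence (α·‖f^{⋆k}‖_{L¹(ℝⁿ)})^{1/k} converges as k → ∞, and its limit equals ‖ℋf‖_{L_∞(ℝⁿ)} = sup_{y ∈ ℝⁿ} |(ℋf)(y)|. -/

import Mathlib

open MeasureTheory Real Filter

noncomputable def Htransform (n : ℕ) (a b : ℝ) (f : (Fin n → ℝ) → ℝ)
    (y : Fin n → ℝ) : ℝ :=
  (2 * Real.pi) ^ (-(n : ℝ) / 2) *
    ∫ x, (a * Real.cos (∑ i, x i * y i) + b * Real.sin (∑ i, x i * y i)) * f x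

noncomputable def Kab (n : ℕ) (a b : ℝ) (f : (Fin n → ℝ) → ℝ) (x v : Fin n → ℝ) : ℝ :=
  (3 * a ^ 2 - b ^ 2) * f (x - v) +
    (a ^ 2 + b ^ 2) * (f (x + v) + f (-x + v) - f (-x - v))

noncomputable def Hconv (n : ℕ) (a b : ℝ) (f g : (Fin n → ℝ) → ℝ)
    (x : Fin n → ℝ) : ℝ :=
  (1 / (4 * a * (2 * Real.pi) ^ ((n : ℝ) / 2))) * ∫ v, Kab n a b f x v * g v

/-- Convolution powers: `Hpow n a b f k` is `f^{⋆k}`, with `f^{⋆1} = f` and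
`f^{⋆(k+1)} = f ⋆_ℋ f^{⋆k}` (the value at `k = 0` is irrelevant). -/
noncomputable def Hpow (n : ℕ) (a b : ℝ) (f : (Fin n → ℝ) → ℝ) :
    ℕ → ((Fin n → ℝ) → ℝ)
  | 0 => 0
  | 1 => f
  | (k + 2) => Hconv n a b f (Hpow n a b f (k + 1))

open scoped Convolution ComplexConjugate

/-- Convolution of real-valued functions on `ℝⁿ`. -/
noncomputable abbrev realConv {n : ℕ} (f g : (Fin n → ℝ) → ℝ) : (Fin n → ℝ) → ℝ :=
  f ⋆[ContinuousLinearMap.mul ℝ ℝ, volume] g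

/-- The normalised Fourier transform with kernel `exp (i x·y)`; its real and imaginary parts are
the cosine and sine transforms. -/
noncomputable def fourierExp {n : ℕ} (f : (Fin n → ℝ) → ℝ) (y : Fin n → ℝ) : ℂ :=
  ((2 * Real.pi) ^ (-(n : ℝ) / 2) : ℝ) *
    ∫ x, Complex.exp ((∑ i, x i * y i : ℝ) * Complex.I) * f x

section Fourier

variable {n : ℕ} {f g : (Fin n → ℝ) → ℝ}

lemma norm_exp_dot_mul_I (x y : Fin n → ℝ) :
    ‖Complex.exp ((∑ i, x i * y i : ℝ) * Complex.I)‖ = 1 :=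
  Complex.norm_exp_ofReal_mul_I _

lemma continuous_exp_dot_mul_I (y : Fin n → ℝ) :
    Continuous fun x : Fin n → ℝ => Complex.exp ((∑ i, x i * y i : ℝ) * Complex.I) := by
  fun_prop

lemma integrable_exp_mul (hf : Integrable f) (y : Fin n → ℝ) :
    Integrable fun x => Complex.exp ((∑ i, x i * y i : ℝ) * Complex.I) * (f x : ℂ) := by
  refine hf.ofReal.bdd_mul (c := 1) (continuous_exp_dot_mul_I y).aestronglyMeasurable ?_
  exact Eventually.of_forall fun x => (norm_exp_dot_mul_I x y).le

lemma two_pi_rpow_pos (r : ℝ) : 0 < (2 * Real.pi) ^ r :=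
  Real.rpow_pos_of_pos (by positivity) r

lemma norm_fourierExp_le (f : (Fin n → ℝ) → ℝ) (y : Fin n → ℝ) :
    ‖fourierExp f y‖ ≤ (2 * Real.pi) ^ (-(n : ℝ) / 2) * ∫ x, |f x| := by
  rw [fourierExp, norm_mul, Complex.norm_real, Real.norm_of_nonneg (two_pi_rpow_pos _).le]
  refine mul_le_mul_of_nonneg_left ?_ (two_pi_rpow_pos _).le
  refine (norm_integral_le_integral_norm _).trans_eq ?_
  refine integral_congr_ae (Eventually.of_forall fun x => ?_)
  simp [-Complex.ofReal_sum, -Complex.ofReal_mul]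

lemma fourierExp_congr (h : f =ᵐ[volume] g) : fourierExp f = fourierExp g := by
  ext y
  unfold fourierExp
  congr 1
  refine integral_congr_ae ?_
  filter_upwards [h] with x hx
  rw [hx]

lemma fourierExp_add (hf : Integrable f) (hg : Integrable g) (y : Fin n → ℝ) :
    fourierExp (f + g) y = fourierExp f y + fourierExp g y := by
  unfold fourierExp
  rw [← mul_add, ← integral_add (integrable_exp_mul hf y) (integrable_exp_mul hg y)]
  simp [mul_add]

lemma fourierExp_smul (c : ℝ) (y : Fin n → ℝ) :
    fourierExp (c • f) y = c * fourierExp f y := by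
  have h : ∫ x, Complex.exp ((∑ i, x i * y i : ℝ) * Complex.I) * ((c • f) x : ℂ) =
      c * ∫ x, Complex.exp ((∑ i, x i * y i : ℝ) * Complex.I) * (f x : ℂ) := by
    rw [← integral_const_mul]
    congr 1
    ext x
    simp [mul_left_comm]
  rw [fourierExp, fourierExp, h, mul_left_comm]

lemma fourierExp_comp_neg (f : (Fin n → ℝ) → ℝ) (y : Fin n → ℝ) :
    fourierExp (fun x => f (-x)) y = conj (fourierExp f y) := by
  unfold fourierExp
  rw [map_mul, Complex.conj_ofReal, ← integral_conj, ← integral_neg_eq_self]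
  congr 2
  ext x
  simp [← Complex.exp_conj]

lemma fourierExp_neg (f : (Fin n → ℝ) → ℝ) (y : Fin n → ℝ) :
    fourierExp f (-y) = conj (fourierExp f y) := by
  unfold fourierExp
  rw [map_mul, Complex.conj_ofReal, ← integral_conj]
  congr 2
  ext x
  simp [← Complex.exp_conj]

lemma fourierExp_realConv (hf : Integrable f) (hg : Integrable g) (y : Fin n → ℝ) :
    fourierExp (realConv f g) y =
      ((2 * Real.pi) ^ ((n : ℝ) / 2) : ℝ) * (fourierExp f y * fourierExp g y) := by
  have h : (fun x => Complex.exp ((∑ i, x i * y i : ℝ) * Complex.I) * (realConv f g x : ℂ)) =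
      (fun x => Complex.exp ((∑ i, x i * y i : ℝ) * Complex.I) * (f x : ℂ))
        ⋆[ContinuousLinearMap.mul ℝ ℂ, volume]
        (fun x => Complex.exp ((∑ i, x i * y i : ℝ) * Complex.I) * (g x : ℂ)) := by
    ext x
    rw [realConv, convolution_def, convolution_def, ← integral_complex_ofReal,
      ← integral_const_mul]
    congr 1
    ext t
    have : Complex.exp ((∑ i, x i * y i : ℝ) * Complex.I) =
        Complex.exp ((∑ i, t i * y i : ℝ) * Complex.I) *
          Complex.exp ((∑ i, (x - t) i * y i : ℝ) * Complex.I) := by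
      rw [← Complex.exp_add, ← add_mul, ← Complex.ofReal_add, ← Finset.sum_add_distrib]
      congr 4
      ext i
      simp
      ring
    rw [this]
    simp only [ContinuousLinearMap.mul_apply', Complex.ofReal_mul]
    ring
  have hc : (((2 * Real.pi) ^ ((n : ℝ) / 2) : ℝ) : ℂ) *
      ((2 * Real.pi) ^ (-(n : ℝ) / 2) : ℝ) = 1 := by
    rw [← Complex.ofReal_mul, ← Real.rpow_add (by positivity)]
    simp [neg_div]
  unfold fourierExp
  rw [h, integral_convolution _ (integrable_exp_mul hf y) (integrable_exp_mul hg y),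
    ContinuousLinearMap.mul_apply']
  linear_combination (-((((2 * Real.pi) ^ (-(n : ℝ) / 2) : ℝ) : ℂ) *
    (∫ x, Complex.exp ((∑ i, x i * y i : ℝ) * Complex.I) * (f x : ℂ)) *
    (∫ x, Complex.exp ((∑ i, x i * y i : ℝ) * Complex.I) * (g x : ℂ)))) * hc

lemma integral_abs_realConv_le (hf : Integrable f) (hg : Integrable g) :
    ∫ x, |realConv f g x| ≤ (∫ x, |f x|) * ∫ x, |g x| := by
  calc ∫ x, |realConv f g x|
      ≤ ∫ x, realConv (fun x => |f x|) (fun x => |g x|) x := by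
        refine integral_mono (hf.integrable_convolution _ hg).abs
          (hf.abs.integrable_convolution _ hg.abs) fun x => ?_
        simp only [realConv, convolution_def, ContinuousLinearMap.mul_apply']
        exact (abs_integral_le_integral_abs).trans_eq (by simp [abs_mul])
    _ = _ := by
        rw [realConv, integral_convolution _ hf.abs hg.abs, ContinuousLinearMap.mul_apply']

/-- An integrable function with vanishing Fourier transform vanishes almost everywhere. -/
lemma ae_eq_zero_of_fourierExp_eq_zero (hf : Integrable f) (h : ∀ y, fourierExp f y = 0) :
    f =ᵐ[volume] 0 := by
  have key : ∀ {u : (Fin n → ℝ) → ℝ}, Integrable u → ∀ L : StrongDual ℝ (Fin n → ℝ),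
      charFunDual (volume.withDensity fun x => ENNReal.ofReal (u x)) L =
        ∫ x, Complex.exp ((L x : ℝ) * Complex.I) * ((max (u x) 0 : ℝ) : ℂ) := by
    intro u hu L
    rw [charFunDual_apply, integral_withDensity_eq_integral_toReal_smul₀
      hu.aemeasurable.ennreal_ofReal (by simp)]
    congr 1
    ext x
    rw [ENNReal.toReal_ofReal', Complex.real_smul, mul_comm]
  have hfn : Integrable (fun x => -f x) := hf.neg
  have fin : ∀ {u : (Fin n → ℝ) → ℝ}, Integrable u →
      ∫⁻ x, ENNReal.ofReal (u x) ≠ ⊤ := fun hu => hu.lintegral_lt_top.ne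
  have : IsFiniteMeasure (volume.withDensity fun x => ENNReal.ofReal (f x)) :=
    isFiniteMeasure_withDensity (fin hf)
  have : IsFiniteMeasure (volume.withDensity fun x => ENNReal.ofReal (-f x)) :=
    isFiniteMeasure_withDensity (fin hfn)
  have hm : (volume.withDensity fun x => ENNReal.ofReal (f x)) =
      volume.withDensity fun x => ENNReal.ofReal (-f x) := by
    refine Measure.ext_of_charFunDual (funext fun L => ?_)
    rw [key hf L, key hfn L, ← sub_eq_zero]
    obtain ⟨w, hL⟩ : ∃ w : Fin n → ℝ, ∀ x, L x = ∑ i, x i * w i := by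
      refine ⟨fun i => L (Pi.single i 1), fun x => ?_⟩
      conv_lhs => rw [pi_eq_sum_univ' x]
      simp
    have h0 := h w
    rw [fourierExp, mul_eq_zero, Complex.ofReal_eq_zero] at h0
    replace h0 := h0.resolve_left (two_pi_rpow_pos _).ne'
    simp_rw [hL]
    rw [← integral_sub (integrable_exp_mul hf.pos_part _) (integrable_exp_mul hf.neg_part _), ← h0]
    congr 1
    ext x
    rw [← mul_sub, ← Complex.ofReal_sub]
    congr 2
    rcases le_total (f x) 0 with hx | hx <;> simp [hx]
  rw [withDensity_eq_iff hf.aemeasurable.ennreal_ofReal hfn.aemeasurable.ennreal_ofReal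
    (fin hf)] at hm
  filter_upwards [hm] with x hx
  rcases le_total (f x) 0 with h0 | h0
  · rw [ENNReal.ofReal_of_nonpos h0, eq_comm, ENNReal.ofReal_eq_zero] at hx
    exact le_antisymm h0 (neg_nonpos.mp hx)
  · rw [ENNReal.ofReal_of_nonpos (by linarith : -f x ≤ 0), ENNReal.ofReal_eq_zero] at hx
    exact le_antisymm hx h0

end Fourier

section HConvolution

variable {n : ℕ} {a b : ℝ} {f g : (Fin n → ℝ) → ℝ}

lemma ae_eq_of_fourierExp_eq (hf : Integrable f) (hg : Integrable g)
    (h : ∀ y, fourierExp f y = fourierExp g y) : f =ᵐ[volume] g := by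
  have h0 := ae_eq_zero_of_fourierExp_eq_zero (hf.add (hg.smul (-1 : ℝ))) fun y => by
    rw [fourierExp_add hf (hg.smul _), fourierExp_smul, h]
    push_cast
    ring
  filter_upwards [h0] with x hx
  have : f x + (-1 : ℝ) * g x = 0 := hx
  linarith

/-- The multiplication that `⋆_ℋ` induces on Fourier transforms. -/
noncomputable def hMul (a b : ℝ) (z w : ℂ) : ℂ :=
  ⟨a * (z.re * w.re) + b ^ 2 / a * (z.im * w.im), a * (z.re * w.im + z.im * w.re)⟩

lemma hMul_comm (a b : ℝ) (z w : ℂ) : hMul a b z w = hMul a b w z := by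
  apply Complex.ext <;> simp only [hMul] <;> ring

lemma hMul_left_comm (ha : a ≠ 0) (b : ℝ) (z w u : ℂ) :
    hMul a b z (hMul a b w u) = hMul a b w (hMul a b z u) := by
  apply Complex.ext <;> simp only [hMul] <;> field_simp <;> ring

lemma Hconv_eq_realConv {x : Fin n → ℝ}
    (h₁ : ConvolutionExistsAt f g x (ContinuousLinearMap.mul ℝ ℝ) volume)
    (h₂ : ConvolutionExistsAt f (fun x => g (-x)) x (ContinuousLinearMap.mul ℝ ℝ) volume)
    (h₃ : ConvolutionExistsAt (fun x => f (-x)) g x (ContinuousLinearMap.mul ℝ ℝ) volume)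
    (h₄ : ConvolutionExistsAt (fun x => f (-x)) (fun x => g (-x)) x
      (ContinuousLinearMap.mul ℝ ℝ) volume) :
    Hconv n a b f g x = (1 / (4 * a * (2 * Real.pi) ^ ((n : ℝ) / 2))) *
      ((3 * a ^ 2 - b ^ 2) * realConv f g x + (a ^ 2 + b ^ 2) *
        (realConv f (fun x => g (-x)) x + realConv (fun x => f (-x)) g x
          - realConv (fun x => f (-x)) (fun x => g (-x)) x)) := by
  have i₁ : Integrable fun v => f (x - v) * g v := h₁.integrable_swap
  have i₂ : Integrable fun v => f (x + v) * g v := by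
    simpa [ContinuousLinearMap.mul_apply'] using h₂.integrable_swap.comp_neg
  have i₃ : Integrable fun v => f (-x + v) * g v := by
    refine h₃.integrable_swap.congr (Eventually.of_forall fun v => ?_)
    simp [neg_add_eq_sub]
  have i₄ : Integrable fun v => f (-x - v) * g v := by
    refine h₄.integrable_swap.comp_neg.congr (Eventually.of_forall fun v => ?_)
    simp [sub_eq_add_neg, add_comm]
  have e₁ : realConv f g x = ∫ v, f (x - v) * g v := convolution_mul_swap
  have e₂ : realConv f (fun x => g (-x)) x = ∫ v, f (x + v) * g v := by
    rw [realConv, convolution_mul_swap, ← integral_neg_eq_self]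
    simp
  have e₃ : realConv (fun x => f (-x)) g x = ∫ v, f (-x + v) * g v := by
    rw [realConv, convolution_mul_swap]
    simp [neg_add_eq_sub]
  have e₄ : realConv (fun x => f (-x)) (fun x => g (-x)) x = ∫ v, f (-x - v) * g v := by
    rw [realConv, convolution_mul_swap, ← integral_neg_eq_self]
    simp [sub_eq_add_neg, add_comm]
  have i₂₃ : Integrable fun v => f (x + v) * g v + f (-x + v) * g v := i₂.add i₃
  have i₂₃₄ : Integrable fun v => f (x + v) * g v + f (-x + v) * g v - f (-x - v) * g v :=
    i₂₃.sub i₄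
  rw [Hconv, e₁, e₂, e₃, e₄, ← integral_add i₂ i₃, ← integral_sub i₂₃ i₄,
    ← integral_const_mul (3 * a ^ 2 - b ^ 2), ← integral_const_mul (a ^ 2 + b ^ 2),
    ← integral_add (i₁.const_mul _) (i₂₃₄.const_mul _)]
  congr 2
  ext v
  simp only [Kab]
  ring

lemma Hconv_ae_eq_realConv (a b : ℝ) (hf : Integrable f) (hg : Integrable g) :
    Hconv n a b f g =ᵐ[volume] (1 / (4 * a * (2 * Real.pi) ^ ((n : ℝ) / 2))) •
      ((3 * a ^ 2 - b ^ 2) • realConv f g + (a ^ 2 + b ^ 2) •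
        (realConv f (fun x => g (-x)) + realConv (fun x => f (-x)) g
          + (-1 : ℝ) • realConv (fun x => f (-x)) (fun x => g (-x)))) := by
  filter_upwards [hf.ae_convolution_exists (ContinuousLinearMap.mul ℝ ℝ) hg,
    hf.ae_convolution_exists (ContinuousLinearMap.mul ℝ ℝ) hg.comp_neg,
    hf.comp_neg.ae_convolution_exists (ContinuousLinearMap.mul ℝ ℝ) hg,
    hf.comp_neg.ae_convolution_exists (ContinuousLinearMap.mul ℝ ℝ) hg.comp_neg]
    with x h₁ h₂ h₃ h₄
  rw [Hconv_eq_realConv h₁ h₂ h₃ h₄]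
  simp only [Pi.smul_apply, Pi.add_apply, smul_eq_mul]
  ring

lemma integrable_realConv (hf : Integrable f) (hg : Integrable g) : Integrable (realConv f g) :=
  hf.integrable_convolution _ hg

lemma integrable_Hconv (a b : ℝ) (hf : Integrable f) (hg : Integrable g) :
    Integrable (Hconv n a b f g) := by
  refine Integrable.congr ?_ (Hconv_ae_eq_realConv a b hf hg).symm
  exact (((integrable_realConv hf hg).smul _).add
    ((((integrable_realConv hf hg.comp_neg).add (integrable_realConv hf.comp_neg hg)).add
      ((integrable_realConv hf.comp_neg hg.comp_neg).smul _)).smul _)).smul _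

lemma fourierExp_Hconv (ha : a ≠ 0) (b : ℝ) (hf : Integrable f) (hg : Integrable g)
    (y : Fin n → ℝ) :
    fourierExp (Hconv n a b f g) y = hMul a b (fourierExp f y) (fourierExp g y) := by
  have i₁ := integrable_realConv hf hg
  have i₂ := integrable_realConv hf hg.comp_neg
  have i₃ := integrable_realConv hf.comp_neg hg
  have i₄ := integrable_realConv hf.comp_neg hg.comp_neg
  rw [fourierExp_congr (Hconv_ae_eq_realConv a b hf hg), fourierExp_smul,
    fourierExp_add (i₁.smul _) (((i₂.add i₃).add (i₄.smul _)).smul _), fourierExp_smul,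
    fourierExp_smul, fourierExp_add (i₂.add i₃) (i₄.smul _), fourierExp_add i₂ i₃,
    fourierExp_smul, fourierExp_realConv hf hg, fourierExp_realConv hf hg.comp_neg,
    fourierExp_realConv hf.comp_neg hg, fourierExp_realConv hf.comp_neg hg.comp_neg,
    fourierExp_comp_neg, fourierExp_comp_neg]
  have hc := (two_pi_rpow_pos ((n : ℝ) / 2)).ne'
  generalize (2 * Real.pi) ^ ((n : ℝ) / 2) = c at hc
  generalize fourierExp f y = z
  generalize fourierExp g y = w
  apply Complex.ext <;>
    simp only [hMul, Complex.ofReal_re, Complex.ofReal_im, Complex.add_re, Complex.add_im,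
      Complex.mul_re, Complex.mul_im, Complex.conj_re, Complex.conj_im] <;>
    field_simp <;> ring

lemma integral_abs_Hconv_le (a b : ℝ) (hf : Integrable f) (hg : Integrable g) :
    ∫ x, |Hconv n a b f g x| ≤ |1 / (4 * a * (2 * Real.pi) ^ ((n : ℝ) / 2))| *
      (|3 * a ^ 2 - b ^ 2| + 3 * (a ^ 2 + b ^ 2)) * (∫ x, |f x|) * ∫ x, |g x| := by
  have i₁ := integrable_realConv hf hg
  have i₂ := integrable_realConv hf hg.comp_neg
  have i₃ := integrable_realConv hf.comp_neg hg
  have i₄ := integrable_realConv hf.comp_neg hg.comp_neg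
  have b₁ := integral_abs_realConv_le hf hg
  have b₂ := integral_abs_realConv_le hf hg.comp_neg
  have b₃ := integral_abs_realConv_le hf.comp_neg hg
  have b₄ := integral_abs_realConv_le hf.comp_neg hg.comp_neg
  have hneg : ∀ u : (Fin n → ℝ) → ℝ, ∫ x, |u (-x)| = ∫ x, |u x| := fun u =>
    integral_neg_eq_self (fun x => |u x|) volume
  rw [hneg] at b₂ b₃ b₄
  rw [hneg] at b₄
  have hq : 0 ≤ a ^ 2 + b ^ 2 := by positivity
  have i₂₃ : Integrable fun x => |realConv f (fun x => g (-x)) x| +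
      |realConv (fun x => f (-x)) g x| := i₂.abs.add i₃.abs
  have i₂₃₄ : Integrable fun x => |realConv f (fun x => g (-x)) x| +
      |realConv (fun x => f (-x)) g x| + |realConv (fun x => f (-x)) (fun x => g (-x)) x| :=
    i₂₃.add i₄.abs
  calc ∫ x, |Hconv n a b f g x|
      ≤ ∫ x, |1 / (4 * a * (2 * Real.pi) ^ ((n : ℝ) / 2))| * (|3 * a ^ 2 - b ^ 2| *
          |realConv f g x| + (a ^ 2 + b ^ 2) * (|realConv f (fun x => g (-x)) x| +
          |realConv (fun x => f (-x)) g x| +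
          |realConv (fun x => f (-x)) (fun x => g (-x)) x|)) := by
        refine integral_mono_ae (integrable_Hconv a b hf hg).abs
          (((i₁.abs.const_mul _).add (i₂₃₄.const_mul _)).const_mul _) ?_
        filter_upwards [Hconv_ae_eq_realConv a b hf hg] with x hx
        simp only [hx, Pi.smul_apply, Pi.add_apply, smul_eq_mul]
        rw [abs_mul]
        refine mul_le_mul_of_nonneg_left ?_ (abs_nonneg _)
        refine (abs_add_le _ _).trans ?_
        rw [abs_mul, abs_mul, abs_of_nonneg hq]
        gcongr
        refine (abs_add_le _ _).trans ?_
        rw [neg_one_mul, abs_neg]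
        gcongr
        exact abs_add_le _ _
    _ = |1 / (4 * a * (2 * Real.pi) ^ ((n : ℝ) / 2))| * (|3 * a ^ 2 - b ^ 2| *
          (∫ x, |realConv f g x|) + (a ^ 2 + b ^ 2) * ((∫ x, |realConv f (fun x => g (-x)) x|) +
          (∫ x, |realConv (fun x => f (-x)) g x|) +
          ∫ x, |realConv (fun x => f (-x)) (fun x => g (-x)) x|)) := by
        rw [integral_const_mul, integral_add (i₁.abs.const_mul _)
          (i₂₃₄.const_mul _), integral_const_mul, integral_const_mul,
          integral_add i₂₃ i₄.abs, integral_add i₂.abs i₃.abs]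
    _ ≤ |1 / (4 * a * (2 * Real.pi) ^ ((n : ℝ) / 2))| * (|3 * a ^ 2 - b ^ 2| *
          ((∫ x, |f x|) * ∫ x, |g x|) + (a ^ 2 + b ^ 2) * ((∫ x, |f x|) * (∫ x, |g x|) +
          (∫ x, |f x|) * (∫ x, |g x|) + (∫ x, |f x|) * ∫ x, |g x|)) := by
        gcongr
    _ = _ := by ring

lemma Htransform_eq (a b : ℝ) (hf : Integrable f) (y : Fin n → ℝ) :
    Htransform n a b f y = a * (fourierExp f y).re + b * (fourierExp f y).im := by
  have h := integrable_exp_mul hf y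
  have h₁ : Integrable fun x =>
      (Complex.exp ((∑ i, x i * y i : ℝ) * Complex.I) * (f x : ℂ)).re := h.re
  have h₂ : Integrable fun x =>
      (Complex.exp ((∑ i, x i * y i : ℝ) * Complex.I) * (f x : ℂ)).im := h.im
  have hre := integral_re h
  have him := integral_im h
  simp only [RCLike.re_eq_complex_re, RCLike.im_eq_complex_im] at hre him
  rw [fourierExp, Complex.re_ofReal_mul, Complex.im_ofReal_mul, ← hre, ← him, mul_left_comm a,
    mul_left_comm b, ← mul_add, ← integral_const_mul, ← integral_const_mul,
    ← integral_add (h₁.const_mul a) (h₂.const_mul b), Htransform]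
  congr 2
  ext x
  simp only [Complex.re_mul_ofReal,
    Complex.im_mul_ofReal, Complex.exp_ofReal_mul_I_re, Complex.exp_ofReal_mul_I_im]
  ring

end HConvolution

section Powers

variable {n : ℕ} {a b : ℝ} {f : (Fin n → ℝ) → ℝ}

lemma integrable_Hpow (a b : ℝ) (hf : Integrable f) (k : ℕ) :
    Integrable (Hpow n a b f (k + 1)) := by
  induction k with
  | zero => exact hf
  | succ k ih => exact integrable_Hconv a b hf ih

/-- Closed form of the powers with respect to `hMul`, in terms of the two characters
`a * re + b * im` and `a * re - b * im`. -/
lemma hMul_pow_form (ha : a ≠ 0) {z : ℂ} {w : ℕ → ℂ} (h0 : w 0 = z)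
    (hs : ∀ k, w (k + 1) = hMul a b z (w k)) {R : ℝ}
    (h₁ : |a * z.re + b * z.im| ≤ R) (h₂ : |a * z.re - b * z.im| ≤ R) (k : ℕ) :
    ∃ t : ℝ, (w k).im = z.im * t ∧ |t| ≤ (k + 1) * R ^ k ∧
      (a * z.re + b * z.im) ^ (k + 1) - (a * z.re - b * z.im) ^ (k + 1) = 2 * (b * z.im) * t ∧
      2 * (a * (w k).re) = (a * z.re + b * z.im) ^ (k + 1) + (a * z.re - b * z.im) ^ (k + 1) := by
  have hR : 0 ≤ R := (abs_nonneg _).trans h₁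
  induction k with
  | zero => exact ⟨1, by simp [h0], by simp, by ring, by rw [h0]; ring⟩
  | succ k ih =>
    obtain ⟨t, ht₁, ht₂, ht₃, ht₄⟩ := ih
    refine ⟨a * z.re * t + a * (w k).re, ?_, ?_, ?_, ?_⟩
    · rw [hs]
      simp only [hMul]
      rw [ht₁]
      ring
    · have e₁ : |a * z.re| ≤ R := by
        rw [abs_le] at *
        constructor <;> linarith [h₁.1, h₁.2, h₂.1, h₂.2]
      have e₂ : |a * (w k).re| ≤ R ^ (k + 1) := by
        have p₁ := pow_le_pow_left₀ (abs_nonneg _) h₁ (k + 1)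
        have p₂ := pow_le_pow_left₀ (abs_nonneg _) h₂ (k + 1)
        rw [← abs_pow, abs_le] at p₁ p₂
        rw [abs_le]
        constructor <;> linarith [p₁.1, p₁.2, p₂.1, p₂.2]
      calc |a * z.re * t + a * (w k).re| ≤ |a * z.re| * |t| + |a * (w k).re| := by
            rw [← abs_mul]; exact abs_add_le _ _
        _ ≤ R * ((k + 1) * R ^ k) + R ^ (k + 1) := by gcongr
        _ = _ := by push_cast; ring
    · linear_combination (a * z.re) * ht₃ - (b * z.im) * ht₄
    · rw [hs]
      have : a * (hMul a b z (w k)).re =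
          a * z.re * (a * (w k).re) + b * z.im * (b * (w k).im) := by
        simp only [hMul]
        field_simp
      rw [this, ht₁]
      linear_combination (a * z.re) * ht₄ - (b * z.im) * ht₃

lemma fourierExp_Hpow_succ (ha : a ≠ 0) (b : ℝ) (hf : Integrable f) (y : Fin n → ℝ) (k : ℕ) :
    fourierExp (Hpow n a b f (k + 1 + 1)) y =
      hMul a b (fourierExp f y) (fourierExp (Hpow n a b f (k + 1)) y) :=
  fourierExp_Hconv ha b hf (integrable_Hpow a b hf k) y

lemma Htransform_neg (a b : ℝ) (hf : Integrable f) (y : Fin n → ℝ) :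
    Htransform n a b f (-y) = a * (fourierExp f y).re - b * (fourierExp f y).im := by
  rw [Htransform_eq a b hf, fourierExp_neg]
  simp [sub_eq_add_neg]

/-- `ℋ` turns convolution powers into powers. -/
lemma Htransform_Hpow (ha : a ≠ 0) (b : ℝ) (hf : Integrable f) (y : Fin n → ℝ) (k : ℕ) :
    Htransform n a b (Hpow n a b f (k + 1)) y = Htransform n a b f y ^ (k + 1) := by
  obtain ⟨t, ht₁, -, ht₃, ht₄⟩ := hMul_pow_form (z := fourierExp f y)
    (w := fun k => fourierExp (Hpow n a b f (k + 1)) y) ha rfl (fourierExp_Hpow_succ ha b hf y) (le_max_left _ _) (le_max_right _ _) k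
  rw [Htransform_eq a b (integrable_Hpow a b hf k), Htransform_eq a b hf]
  linear_combination b * ht₁ + ht₄ / 2 - ht₃ / 2

lemma norm_fourierExp_Hpow_le (ha : a ≠ 0) (b : ℝ) (hf : Integrable f) {R : ℝ}
    (hR : ∀ y, |Htransform n a b f y| ≤ R) (y : Fin n → ℝ) (k : ℕ) :
    ‖fourierExp (Hpow n a b f (k + 1)) y‖ ≤
      ((|a| + |b|) / |a| + (k + 1)) * R ^ k * ‖fourierExp f y‖ := by
  have h₁ := hR y
  have h₂ := hR (-y)
  rw [Htransform_eq a b hf] at h₁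
  rw [Htransform_neg a b hf] at h₂
  have hR0 : 0 ≤ R := (abs_nonneg _).trans h₁
  obtain ⟨t, ht₁, ht₂, -, ht₄⟩ := hMul_pow_form (z := fourierExp f y)
    (w := fun k => fourierExp (Hpow n a b f (k + 1)) y) ha rfl (fourierExp_Hpow_succ ha b hf y) h₁ h₂ k
  have hre := Complex.abs_re_le_norm (fourierExp f y)
  have him := Complex.abs_im_le_norm (fourierExp f y)
  set z := fourierExp f y
  set w := fourierExp (Hpow n a b f (k + 1)) y
  have hp : ∀ u : ℝ, |u| ≤ R → |u| ≤ (|a| + |b|) * ‖z‖ →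
      |u ^ (k + 1)| ≤ R ^ k * ((|a| + |b|) * ‖z‖) := fun u hu hu' => by
    rw [pow_succ, abs_mul, abs_pow]
    gcongr
  have hz₁ : |a * z.re| ≤ |a| * ‖z‖ := by rw [abs_mul]; gcongr
  have hz₂ : |b * z.im| ≤ |b| * ‖z‖ := by rw [abs_mul]; gcongr
  have q₁ := hp _ h₁ ((abs_add_le _ _).trans (by linarith))
  have q₂ := hp _ h₂ ((abs_sub _ _).trans (by linarith))
  have e₁ : |a| * |w.re| ≤ R ^ k * ((|a| + |b|) * ‖z‖) := by
    rw [← abs_mul]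
    rw [abs_le] at *
    constructor <;> linarith [q₁.1, q₁.2, q₂.1, q₂.2]
  have e₂ : |w.im| ≤ (k + 1) * R ^ k * ‖z‖ := by
    rw [ht₁, abs_mul, mul_comm]
    gcongr
  have e₃ : |w.re| ≤ (|a| + |b|) / |a| * R ^ k * ‖z‖ := by
    rw [div_mul_eq_mul_div, div_mul_eq_mul_div, le_div_iff₀ (abs_pos.mpr ha)]
    linarith
  linarith [Complex.norm_le_abs_re_add_abs_im w]

end Powers

section Operators

/-- In a commutative, associative bilinear structure, exponential growth bounds on the powers of
`g` perturb to bounds on the powers of a nearby `f`. -/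
lemma exists_norm_pow_apply_le {E : Type*} [NormedAddCommGroup E] [NormedSpace ℝ E]
    (T : E →L[ℝ] E →L[ℝ] E) (hcomm : ∀ u v, T u v = T v u)
    (hleft : ∀ u v w, T u (T v w) = T v (T u w)) (f g : E) {M ρ : ℝ} (hρ : 0 < ρ)
    (hg : ∀ k : ℕ, ‖(T g ^ k) g‖ ≤ M * ρ ^ k) :
    ∃ M' : ℝ, ∀ k : ℕ, ‖(T f ^ k) f‖ ≤ M' * (ρ + ‖T (f - g)‖) ^ k := by
  have hcm : ∀ u v, Commute (T u) (T v) := fun u v => ContinuousLinearMap.ext fun w => hleft u v w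
  set M₁ := max 1 (‖T‖ * M / ρ)
  have hM₁ : 0 ≤ M₁ := zero_le_one.trans (le_max_left _ _)
  have h₁ : ∀ (j : ℕ) (u : E), ‖(T g ^ j) u‖ ≤ M₁ * ρ ^ j * ‖u‖ := by
    intro j u
    rcases j with _ | j
    · simpa using le_mul_of_one_le_left (norm_nonneg u) (le_max_left _ _)
    · have e : (T g ^ (j + 1)) u = T u ((T g ^ j) g) := by
        rw [pow_succ, mul_apply_eq_comp, hcomm g u]
        exact congrArg (fun S : E →L[ℝ] E => S g) (((hcm g u).pow_left j).eq)
      rw [e]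
      calc ‖T u ((T g ^ j) g)‖ ≤ ‖T‖ * ‖u‖ * ‖(T g ^ j) g‖ := T.le_opNorm₂ _ _
        _ ≤ ‖T‖ * ‖u‖ * (M * ρ ^ j) := by gcongr; exact hg j
        _ = ‖T‖ * M / ρ * ρ ^ (j + 1) * ‖u‖ := by field_simp; ring
        _ ≤ M₁ * ρ ^ (j + 1) * ‖u‖ := by gcongr; exact le_max_right _ _
  have h₂ : ∀ (k j : ℕ) (u : E),
      ‖(T f ^ k) ((T g ^ j) u)‖ ≤ M₁ * ρ ^ j * (ρ + ‖T (f - g)‖) ^ k * ‖u‖ := by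
    intro k
    induction k with
    | zero => intro j u; simpa using h₁ j u
    | succ k ih =>
      intro j u
      have e : (T f ^ (k + 1)) ((T g ^ j) u) =
          (T f ^ k) ((T g ^ (j + 1)) u) + (T f ^ k) ((T g ^ j) (T (f - g) u)) := by
        have e₁ : (T g ^ j) (T (f - g) u) = T (f - g) ((T g ^ j) u) :=
          congrArg (fun S : E →L[ℝ] E => S u) (((hcm g (f - g)).pow_left j).eq)
        rw [e₁, pow_succ, pow_succ', mul_apply_eq_comp, mul_apply_eq_comp,
          ← map_add]
        simp
      rw [e]
      calc _ ≤ M₁ * ρ ^ (j + 1) * (ρ + ‖T (f - g)‖) ^ k * ‖u‖ +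
            M₁ * ρ ^ j * (ρ + ‖T (f - g)‖) ^ k * ‖T (f - g) u‖ :=
            (norm_add_le _ _).trans (add_le_add (ih _ _) (ih _ _))
        _ ≤ M₁ * ρ ^ (j + 1) * (ρ + ‖T (f - g)‖) ^ k * ‖u‖ +
            M₁ * ρ ^ j * (ρ + ‖T (f - g)‖) ^ k * (‖T (f - g)‖ * ‖u‖) := by
            gcongr; exact (T (f - g)).le_opNorm u
        _ = _ := by ring
  refine ⟨M₁ * ‖f‖, fun k => ?_⟩
  have := h₂ k 0 f
  simp only [pow_zero, mul_one] at this
  exact this.trans_eq (by ring)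

variable {n : ℕ} {a b : ℝ}

lemma l1_ext_of_fourierExp {u v : (Fin n → ℝ) →₁[volume] ℝ}
    (h : ∀ y, fourierExp u y = fourierExp v y) : u = v :=
  Lp.ext (ae_eq_of_fourierExp_eq (L1.integrable_coeFn u) (L1.integrable_coeFn v) h)

lemma fourierExp_coe_add (u v : (Fin n → ℝ) →₁[volume] ℝ) (y : Fin n → ℝ) :
    fourierExp (u + v : (Fin n → ℝ) →₁[volume] ℝ) y = fourierExp u y + fourierExp v y := by
  rw [fourierExp_congr (Lp.coeFn_add u v),
    fourierExp_add (L1.integrable_coeFn u) (L1.integrable_coeFn v)]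

lemma fourierExp_coe_smul (c : ℝ) (u : (Fin n → ℝ) →₁[volume] ℝ) (y : Fin n → ℝ) :
    fourierExp (c • u : (Fin n → ℝ) →₁[volume] ℝ) y = c * fourierExp u y := by
  rw [fourierExp_congr (Lp.coeFn_smul c u), fourierExp_smul]

lemma fourierExp_toL1_Hconv (ha : a ≠ 0) (b : ℝ) (u v : (Fin n → ℝ) →₁[volume] ℝ)
    (y : Fin n → ℝ) :
    fourierExp ((integrable_Hconv a b (L1.integrable_coeFn u) (L1.integrable_coeFn v)).toL1
      (Hconv n a b u v)) y = hMul a b (fourierExp u y) (fourierExp v y) := by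
  rw [fourierExp_congr (Integrable.coeFn_toL1 _),
    fourierExp_Hconv ha b (L1.integrable_coeFn u) (L1.integrable_coeFn v)]

/-- The `ℋ`-convolution as a continuous bilinear map on `L¹`. -/
noncomputable def hconvL (n : ℕ) (ha : a ≠ 0) (b : ℝ) :
    ((Fin n → ℝ) →₁[volume] ℝ) →L[ℝ] ((Fin n → ℝ) →₁[volume] ℝ) →L[ℝ]
      ((Fin n → ℝ) →₁[volume] ℝ) :=
  LinearMap.mkContinuous₂
    (LinearMap.mk₂ ℝ (fun u v => (integrable_Hconv a b (L1.integrable_coeFn u)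
        (L1.integrable_coeFn v)).toL1 (Hconv n a b u v))
      (fun u u' v => l1_ext_of_fourierExp fun y => by
        simp only [fourierExp_toL1_Hconv ha, fourierExp_coe_add]
        apply Complex.ext <;> simp only [hMul, Complex.add_re, Complex.add_im] <;> ring)
      (fun c u v => l1_ext_of_fourierExp fun y => by
        simp only [fourierExp_toL1_Hconv ha, fourierExp_coe_smul]
        apply Complex.ext <;>
          simp only [hMul, Complex.re_ofReal_mul, Complex.im_ofReal_mul] <;> ring)
      (fun u v v' => l1_ext_of_fourierExp fun y => by
        simp only [fourierExp_toL1_Hconv ha, fourierExp_coe_add]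
        apply Complex.ext <;> simp only [hMul, Complex.add_re, Complex.add_im] <;> ring)
      (fun c u v => l1_ext_of_fourierExp fun y => by
        simp only [fourierExp_toL1_Hconv ha, fourierExp_coe_smul]
        apply Complex.ext <;>
          simp only [hMul, Complex.re_ofReal_mul, Complex.im_ofReal_mul] <;> ring))
    (|1 / (4 * a * (2 * Real.pi) ^ ((n : ℝ) / 2))| *
      (|3 * a ^ 2 - b ^ 2| + 3 * (a ^ 2 + b ^ 2)))
    (fun u v => by
      rw [LinearMap.mk₂_apply, L1.norm_of_fun_eq_integral_norm, L1.norm_eq_integral_norm,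
        L1.norm_eq_integral_norm]
      exact integral_abs_Hconv_le a b (L1.integrable_coeFn u) (L1.integrable_coeFn v))

lemma fourierExp_hconvL (ha : a ≠ 0) (b : ℝ) (u v : (Fin n → ℝ) →₁[volume] ℝ) (y : Fin n → ℝ) :
    fourierExp (hconvL n ha b u v) y = hMul a b (fourierExp u y) (fourierExp v y) :=
  fourierExp_toL1_Hconv ha b u v y

lemma hconvL_comm (ha : a ≠ 0) (b : ℝ) (u v : (Fin n → ℝ) →₁[volume] ℝ) :
    hconvL n ha b u v = hconvL n ha b v u :=
  l1_ext_of_fourierExp fun y => by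
    rw [fourierExp_hconvL, fourierExp_hconvL, hMul_comm]

lemma hconvL_left_comm (ha : a ≠ 0) (b : ℝ) (u v w : (Fin n → ℝ) →₁[volume] ℝ) :
    hconvL n ha b u (hconvL n ha b v w) = hconvL n ha b v (hconvL n ha b u w) :=
  l1_ext_of_fourierExp fun y => by
    simp only [fourierExp_hconvL]
    exact hMul_left_comm ha b _ _ _

lemma hconvL_pow_toL1 (ha : a ≠ 0) (b : ℝ) {f : (Fin n → ℝ) → ℝ} (hf : Integrable f) (k : ℕ) :
    (hconvL n ha b (hf.toL1 f) ^ k) (hf.toL1 f) =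
      (integrable_Hpow a b hf k).toL1 (Hpow n a b f (k + 1)) := by
  induction k with
  | zero => rfl
  | succ k ih =>
    rw [pow_succ', mul_apply_eq_comp, ih]
    refine l1_ext_of_fourierExp fun y => ?_
    rw [fourierExp_hconvL, fourierExp_congr (Integrable.coeFn_toL1 _),
      fourierExp_congr (Integrable.coeFn_toL1 _), fourierExp_congr (Integrable.coeFn_toL1 _),
      fourierExp_Hpow_succ ha b hf]

lemma norm_hconvL_pow_toL1 (ha : a ≠ 0) (b : ℝ) {f : (Fin n → ℝ) → ℝ} (hf : Integrable f)
    (k : ℕ) : ‖(hconvL n ha b (hf.toL1 f) ^ k) (hf.toL1 f)‖ = ∫ x, |Hpow n a b f (k + 1) x| := by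
  rw [hconvL_pow_toL1, L1.norm_of_fun_eq_integral_norm]
  rfl

end Operators

section Euclidean

open scoped FourierTransform ContDiff RealInnerProductSpace

variable {n : ℕ} {f g h : (Fin n → ℝ) → ℝ}

/-- A function on `ℝⁿ`, viewed as a complex-valued function on Euclidean space. -/
def complexify (f : (Fin n → ℝ) → ℝ) (v : EuclideanSpace ℝ (Fin n)) : ℂ :=
  f v.ofLp

lemma integrable_complexify (hf : Integrable f) : Integrable (complexify f) :=
  ((PiLp.volume_preserving_ofLp (Fin n)).integrable_comp hf.aestronglyMeasurable).mpr hf |>.ofReal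

lemma fourierExp_eq_fourier (f : (Fin n → ℝ) → ℝ) (w : EuclideanSpace ℝ (Fin n)) :
    fourierExp f (-(2 * Real.pi) • w.ofLp) =
      ((2 * Real.pi) ^ (-(n : ℝ) / 2) : ℝ) * 𝓕 (complexify f) w := by
  rw [fourierExp, Real.fourier_eq']
  congr 1
  rw [← (PiLp.volume_preserving_ofLp (Fin n)).integral_comp
    (MeasurableEquiv.toLp 2 (Fin n → ℝ)).symm.measurableEmbedding]
  congr 1
  ext v
  rw [smul_eq_mul, complexify]
  congr 4
  rw [PiLp.inner_apply, Finset.mul_sum]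
  refine Finset.sum_congr rfl fun i _ => ?_
  simp
  ring

lemma continuous_fourier_complexify (hf : Integrable f) : Continuous (𝓕 (complexify f)) :=
  VectorFourier.fourierIntegral_continuous Real.continuous_fourierChar
    (by exact continuous_inner) (integrable_complexify hf)

lemma integrable_fourier_complexify (hg : ContDiff ℝ ∞ g) (hc : HasCompactSupport g) :
    Integrable (𝓕 (complexify g)) := by
  have h₁ : ContDiff ℝ ∞ (complexify g) :=
    Complex.ofRealCLM.contDiff.comp (hg.comp (PiLp.contDiff_ofLp (p := 2)))
  have h₂ : HasCompactSupport (complexify g) :=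
    (hc.comp_homeomorph (PiLp.continuousLinearEquiv 2 ℝ
      (fun _ : Fin n => ℝ)).toHomeomorph).comp_left (g := ((↑) : ℝ → ℂ)) Complex.ofReal_zero
  have := (𝓕 (h₂.toSchwartzMap h₁)).integrable (μ := volume)
  rwa [SchwartzMap.fourier_coe] at this

/-- A continuous function whose Fourier transform is dominated by an integrable one is bounded. -/
lemma abs_le_of_norm_fourierExp_le (hc : Continuous h) (hh : Integrable h)
    (hg : Integrable (𝓕 (complexify g))) {A : ℝ}
    (hA : ∀ y, ‖fourierExp h y‖ ≤ A * ‖fourierExp g y‖) (x : Fin n → ℝ) :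
    |h x| ≤ A * ∫ w, ‖𝓕 (complexify g) w‖ := by
  have hb : ∀ w, ‖𝓕 (complexify h) w‖ ≤ A * ‖𝓕 (complexify g) w‖ := fun w => by
    have := hA (-(2 * Real.pi) • w.ofLp)
    rw [fourierExp_eq_fourier, fourierExp_eq_fourier, norm_mul, norm_mul, mul_left_comm] at this
    refine le_of_mul_le_mul_left this ?_
    rw [Complex.norm_real, Real.norm_of_nonneg (two_pi_rpow_pos _).le]
    exact two_pi_rpow_pos _
  have hi : Integrable (𝓕 (complexify h)) :=
    (hg.norm.const_mul A).mono' (continuous_fourier_complexify hh).aestronglyMeasurable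
      (Eventually.of_forall hb)
  have hcE : Continuous (complexify h) :=
    Complex.continuous_ofReal.comp (hc.comp (PiLp.continuous_ofLp 2 _))
  have hinv := congrFun (hcE.fourierInv_fourier_eq (integrable_complexify hh) hi)
    (WithLp.toLp 2 x)
  calc |h x| = ‖complexify h (WithLp.toLp 2 x)‖ := by simp [complexify]
    _ ≤ ∫ w, ‖𝓕 (complexify h) w‖ := by
        rw [← hinv, Real.fourierInv_eq]
        refine (norm_integral_le_integral_norm _).trans_eq ?_
        simp
    _ ≤ ∫ w, A * ‖𝓕 (complexify g) w‖ := integral_mono hi.norm (hg.norm.const_mul A) hb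
    _ = _ := integral_const_mul _ _

end Euclidean

section CompactSupport

open scoped FourierTransform ContDiff

variable {n : ℕ} {a b : ℝ} {f g : (Fin n → ℝ) → ℝ}

lemma continuous_Hconv (a b : ℝ) (hc : HasCompactSupport f) (hf : Continuous f)
    (hg : Integrable g) : Continuous (Hconv n a b f g) := by
  have hc' : HasCompactSupport fun x => f (-x) := hc.comp_homeomorph (Homeomorph.neg _)
  have hf' : Continuous fun x => f (-x) := hf.comp continuous_neg
  have l := hg.locallyIntegrable
  have l' := hg.comp_neg.locallyIntegrable
  have e := fun x => Hconv_eq_realConv (a := a) (b := b)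
    (hc.convolutionExists_left (ContinuousLinearMap.mul ℝ ℝ) hf l x)
    (hc.convolutionExists_left (ContinuousLinearMap.mul ℝ ℝ) hf l' x)
    (hc'.convolutionExists_left (ContinuousLinearMap.mul ℝ ℝ) hf' l x)
    (hc'.convolutionExists_left (ContinuousLinearMap.mul ℝ ℝ) hf' l' x)
  rw [funext e]
  have c₁ := hc.continuous_convolution_left (ContinuousLinearMap.mul ℝ ℝ) hf l
  have c₂ := hc.continuous_convolution_left (ContinuousLinearMap.mul ℝ ℝ) hf l'
  have c₃ := hc'.continuous_convolution_left (ContinuousLinearMap.mul ℝ ℝ) hf' l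
  have c₄ := hc'.continuous_convolution_left (ContinuousLinearMap.mul ℝ ℝ) hf' l'
  fun_prop

lemma Hconv_eq_zero_of_lt_norm {r s : ℝ} (hf : ∀ x, r < ‖x‖ → f x = 0)
    (hg : ∀ x, s < ‖x‖ → g x = 0) {x : Fin n → ℝ} (hx : r + s < ‖x‖) :
    Hconv n a b f g x = 0 := by
  rw [Hconv, integral_eq_zero_of_ae (Eventually.of_forall fun v => ?_), mul_zero]
  rcases lt_or_ge s ‖v‖ with hv | hv
  · simp [hg v hv]
  · have h₁ : ‖x‖ ≤ ‖x - v‖ + ‖v‖ := by simpa using norm_add_le (x - v) v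
    have h₂ : ‖x‖ ≤ ‖x + v‖ + ‖v‖ := by simpa using norm_sub_le (x + v) v
    have h₃ : ‖-x + v‖ = ‖x - v‖ := by rw [← norm_neg]; congr 1; abel
    have h₄ : ‖-x - v‖ = ‖x + v‖ := by rw [← norm_neg]; congr 1; abel
    simp only [Kab, Pi.zero_apply]
    rw [hf (x - v) (by linarith), hf (x + v) (by linarith), hf (-x + v) (by linarith),
      hf (-x - v) (by linarith)]
    ring

lemma Hpow_eq_zero_of_lt_norm {r : ℝ} (hf : ∀ x, r < ‖x‖ → f x = 0) (k : ℕ) :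
    ∀ x, (k + 1) * r < ‖x‖ → Hpow n a b f (k + 1) x = 0 := by
  induction k with
  | zero => simpa [Hpow] using hf
  | succ k ih =>
    intro x hx
    refine Hconv_eq_zero_of_lt_norm hf ih ?_
    push_cast at hx
    linarith

lemma continuous_Hpow (a b : ℝ) (hc : HasCompactSupport f) (hf : Continuous f) (k : ℕ) :
    Continuous (Hpow n a b f (k + 1)) := by
  rcases k with _ | k
  · exact hf
  · exact continuous_Hconv a b hc hf (integrable_Hpow a b (hf.integrable_of_hasCompactSupport hc) k)

/-- For a test function, the `L¹` norms of the powers grow at most polynomially relative to the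
powers of a bound for the `ℋ`-transform. -/
lemma exists_integral_abs_Hpow_le (ha : a ≠ 0) (b : ℝ) (hg : ContDiff ℝ ∞ g)
    (hc : HasCompactSupport g) {R : ℝ} (hR : ∀ y, |Htransform n a b g y| ≤ R) :
    ∃ M : ℝ, 0 ≤ M ∧ ∀ k : ℕ,
      ∫ x, |Hpow n a b g (k + 1) x| ≤ M * ((k : ℝ) + 1) ^ (n + 1) * R ^ k := by
  have hgi : Integrable g := hg.continuous.integrable_of_hasCompactSupport hc
  have hR0 : 0 ≤ R := (abs_nonneg _).trans (hR 0)
  obtain ⟨r, hr, hr0⟩ : ∃ r : ℝ, 0 ≤ r ∧ ∀ x, r < ‖x‖ → g x = 0 := by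
    obtain ⟨r, hr⟩ := hc.isCompact.isBounded.exists_norm_le
    refine ⟨max r 0, le_max_right _ _, fun x hx => ?_⟩
    by_contra h
    exact ((hr x (subset_tsupport g h)).trans (le_max_left _ _)).not_gt hx
  set I := ∫ w, ‖𝓕 (complexify g) w‖
  have hI : 0 ≤ I := integral_nonneg fun _ => norm_nonneg _
  set q := (|a| + |b|) / |a|
  have hq : 0 ≤ q := by positivity
  refine ⟨(2 * r) ^ n * ((q + 1) * I), by positivity, fun k => ?_⟩
  have hsup : ∀ x, |Hpow n a b g (k + 1) x| ≤ (q + (k + 1)) * R ^ k * I :=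
    abs_le_of_norm_fourierExp_le (continuous_Hpow a b hc hg.continuous k)
      (integrable_Hpow a b hgi k) (integrable_fourier_complexify hg hc)
      (fun y => norm_fourierExp_Hpow_le ha b hgi hR y k)
  have hk : (0 : ℝ) ≤ (k + 1) * r := by positivity
  have hset : ∫ x, |Hpow n a b g (k + 1) x| =
      ∫ x in Metric.closedBall 0 ((k + 1) * r), |Hpow n a b g (k + 1) x| := by
    refine (setIntegral_eq_integral_of_forall_compl_eq_zero fun x hx => ?_).symm
    rw [mem_closedBall_zero_iff, not_le] at hx
    rw [Hpow_eq_zero_of_lt_norm hr0 k x hx, abs_zero]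
  have hvol : volume.real (Metric.closedBall (0 : Fin n → ℝ) ((k + 1) * r)) =
      (2 * ((k + 1) * r)) ^ n := by
    rw [measureReal_def, Real.volume_pi_closedBall _ hk, ENNReal.toReal_ofReal (by positivity),
      Fintype.card_fin]
  rw [hset]
  calc _ ≤ (q + (k + 1)) * R ^ k * I *
        volume.real (Metric.closedBall (0 : Fin n → ℝ) ((k + 1) * r)) := by
        refine (Real.le_norm_self _).trans (norm_setIntegral_le_of_norm_le_const
          measure_closedBall_lt_top fun x _ => ?_)
        simpa using hsup x
    _ ≤ ((q + 1) * (k + 1)) * R ^ k * I * (2 * ((k + 1) * r)) ^ n := by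
        rw [hvol]
        gcongr
        nlinarith [mul_nonneg hq (Nat.cast_nonneg (α := ℝ) k)]
    _ = _ := by rw [mul_pow, mul_pow]; ring

end CompactSupport

section SpectralRadius

open scoped ContDiff Topology

variable {n : ℕ} {a b : ℝ} {f g : (Fin n → ℝ) → ℝ}

lemma abs_Htransform_le (a b : ℝ) (hf : Integrable f) (y : Fin n → ℝ) :
    |Htransform n a b f y| ≤ (|a| + |b|) * (2 * Real.pi) ^ (-(n : ℝ) / 2) * ∫ x, |f x| := by
  rw [Htransform_eq a b hf, mul_assoc]
  calc _ ≤ |a| * |(fourierExp f y).re| + |b| * |(fourierExp f y).im| := by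
        rw [← abs_mul, ← abs_mul]; exact abs_add_le _ _
    _ ≤ |a| * ‖fourierExp f y‖ + |b| * ‖fourierExp f y‖ := by
        gcongr
        · exact Complex.abs_re_le_norm _
        · exact Complex.abs_im_le_norm _
    _ = (|a| + |b|) * ‖fourierExp f y‖ := by ring
    _ ≤ _ := by gcongr; exact norm_fourierExp_le f y

lemma bddAbove_abs_Htransform (a b : ℝ) (hf : Integrable f) :
    BddAbove (Set.range fun y => |Htransform n a b f y|) :=
  ⟨_, Set.forall_mem_range.mpr (abs_Htransform_le a b hf)⟩

lemma Htransform_sub (a b : ℝ) (hf : Integrable f) (hg : Integrable g) (y : Fin n → ℝ) :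
    Htransform n a b (f - g) y = Htransform n a b f y - Htransform n a b g y := by
  have h : fourierExp g y + fourierExp (f - g) y = fourierExp f y := by
    rw [← fourierExp_add hg (hf.sub hg), add_sub_cancel]
  rw [Htransform_eq a b (hf.sub hg), Htransform_eq a b hf, Htransform_eq a b hg, ← h]
  simp only [Complex.add_re, Complex.add_im]
  ring

lemma abs_Htransform_pow_le (ha : a ≠ 0) (b : ℝ) (hf : Integrable f) (y : Fin n → ℝ) (k : ℕ) :
    |Htransform n a b f y| ^ (k + 1) ≤
      (|a| + |b|) * (2 * Real.pi) ^ (-(n : ℝ) / 2) * ∫ x, |Hpow n a b f (k + 1) x| := by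
  rw [← abs_pow, ← Htransform_Hpow ha b hf]
  exact abs_Htransform_le a b (integrable_Hpow a b hf k) y

/-- A polynomially perturbed geometric sequence is bounded by any larger geometric sequence. -/
lemma exists_mul_pow_mul_pow_le {M R ρ : ℝ} (hM : 0 ≤ M) (hR : 0 ≤ R) (hρ : R < ρ) (m : ℕ) :
    ∃ M' : ℝ, ∀ k : ℕ, M * ((k : ℝ) + 1) ^ m * R ^ k ≤ M' * ρ ^ k := by
  have hρ0 : 0 < ρ := hR.trans_lt hρ
  have ht : Tendsto (fun k : ℕ => ((k : ℝ) + 1) ^ m * (R / ρ) ^ k) atTop (𝓝 0) := by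
    rcases hR.eq_or_lt with rfl | hR
    · refine tendsto_const_nhds.congr' ?_
      filter_upwards [eventually_ne_atTop 0] with k hk
      simp [hk]
    · have h := (tendsto_pow_const_mul_const_pow_of_lt_one m (div_nonneg hR.le hρ0.le)
        ((div_lt_one hρ0).mpr hρ)).comp (tendsto_add_atTop_nat 1) |>.mul_const (R / ρ)⁻¹
      rw [zero_mul] at h
      refine h.congr fun k => ?_
      have : R / ρ ≠ 0 := by positivity
      simp only [Function.comp_apply, Nat.cast_add, Nat.cast_one]
      rw [pow_succ (R / ρ), ← mul_assoc, mul_inv_cancel_right₀ this]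
  obtain ⟨B, hB⟩ := ht.bddAbove_range
  refine ⟨M * B, fun k => ?_⟩
  have h := mul_le_mul_of_nonneg_left (hB ⟨k, rfl⟩) hM
  calc M * ((k : ℝ) + 1) ^ m * R ^ k = M * (((k : ℝ) + 1) ^ m * (R / ρ) ^ k) * ρ ^ k := by
        rw [div_pow]; field_simp
    _ ≤ _ := by gcongr

/-- The powers of `f` grow at most like `ρ ^ k` for every `ρ` exceeding the supremum of the
`ℋ`-transform. -/
lemma exists_integral_abs_Hpow_le_of_iSup_lt (ha : a ≠ 0) (b : ℝ) (hf : Integrable f) {ρ : ℝ}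
    (hρ : ⨆ y, |Htransform n a b f y| < ρ) :
    ∃ M : ℝ, ∀ k : ℕ, ∫ x, |Hpow n a b f (k + 1) x| ≤ M * ρ ^ k := by
  set R := ⨆ y, |Htransform n a b f y|
  have hR0 : 0 ≤ R := Real.iSup_nonneg fun _ => abs_nonneg _
  set C := (|a| + |b|) * (2 * Real.pi) ^ (-(n : ℝ) / 2)
  have hC : 0 ≤ C := mul_nonneg (by positivity) (two_pi_rpow_pos _).le
  set N := ‖hconvL n ha b‖
  have hN : 0 ≤ N := norm_nonneg (hconvL n ha b)
  set ε := (ρ - R) / (2 * (C + N + 1))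
  have hε : 0 < ε := div_pos (sub_pos.mpr hρ) (by positivity)
  have hCN : (C + N + 1) * ε = (ρ - R) / 2 := by
    simp only [ε]; field_simp
  obtain ⟨g, hgc, hgs, hgε⟩ := MemLp.exist_eLpNorm_sub_le (μ := volume) (p := 1)
    ENNReal.one_ne_top le_rfl (memLp_one_iff_integrable.mpr hf) hε
  have hg : Integrable g := hgs.continuous.integrable_of_hasCompactSupport hgc
  have hnorm : ‖hf.toL1 f - hg.toL1 g‖ ≤ ε := by
    rw [← Integrable.toL1_sub, Integrable.norm_toL1_eq_lintegral_enorm,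
      ← eLpNorm_one_eq_lintegral_enorm]
    exact ENNReal.toReal_le_of_le_ofReal hε.le hgε
  have hint : ∫ x, |(f - g) x| ≤ ε := by
    rw [← Integrable.toL1_sub, L1.norm_of_fun_eq_integral_norm] at hnorm
    exact hnorm
  have hgR : ∀ y, |Htransform n a b g y| ≤ R + C * ε := fun y => by
    have h₁ := le_ciSup (bddAbove_abs_Htransform a b hf) y
    have h₂ := (abs_Htransform_le a b (hf.sub hg) y).trans
      (mul_le_mul_of_nonneg_left hint hC)
    rw [Htransform_sub a b hf hg] at h₂
    have h₃ := abs_sub_abs_le_abs_sub (Htransform n a b g y) (Htransform n a b f y)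
    rw [abs_sub_comm] at h₃
    linarith
  obtain ⟨M, hM, hMk⟩ := exists_integral_abs_Hpow_le ha b hgs hgc hgR
  set σ := R + C * ε + ε
  have hσ : 0 < σ := by positivity
  obtain ⟨M₁, hM₁⟩ := exists_mul_pow_mul_pow_le hM (by positivity : 0 ≤ R + C * ε)
    (by linarith : R + C * ε < σ) (n + 1)
  obtain ⟨M₂, hM₂⟩ := exists_norm_pow_apply_le (hconvL n ha b) (hconvL_comm ha b)
    (hconvL_left_comm ha b) (hf.toL1 f) (hg.toL1 g) hσ fun k =>
      (norm_hconvL_pow_toL1 ha b hg k).trans_le ((hMk k).trans (hM₁ k))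
  have hδ : σ + ‖hconvL n ha b (hf.toL1 f - hg.toL1 g)‖ ≤ ρ := by
    have h₁ := ((hconvL n ha b).le_opNorm (hf.toL1 f - hg.toL1 g)).trans
      (mul_le_mul_of_nonneg_left hnorm hN)
    have h₂ : σ + N * ε = R + (C + N + 1) * ε := by simp only [σ]; ring
    linarith
  refine ⟨|M₂|, fun k => ?_⟩
  rw [← norm_hconvL_pow_toL1 ha b hf k]
  refine (hM₂ k).trans ?_
  gcongr
  exact le_abs_self _

/-- If `u k ^ (1 / k)` is asymptotically squeezed between geometric rates `r < R` and `ρ > R`,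
it converges to `R`. -/
lemma tendsto_rpow_one_div_of_geometric_bounds {u : ℕ → ℝ} {R : ℝ} (hu : ∀ k, 0 ≤ u k)
    (hlow : ∀ r, 0 < r → r < R → ∃ c, 0 < c ∧ ∀ k, c * r ^ k ≤ u (k + 1))
    (hupp : ∀ ρ, R < ρ → ∃ C, ∀ k, u (k + 1) ≤ C * ρ ^ k) (hR : 0 ≤ R) :
    Tendsto (fun k : ℕ => u k ^ ((1 : ℝ) / k)) atTop (𝓝 R) := by
  have key : ∀ c s : ℝ, 0 < c → 0 < s →
      Tendsto (fun k : ℕ => (c * s ^ (k - 1)) ^ ((1 : ℝ) / k)) atTop (𝓝 s) := by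
    intro c s hc hs
    have h₁ : Tendsto (fun k : ℕ => (c / s) ^ ((1 : ℝ) / k)) atTop (𝓝 1) := by
      have := (Real.continuousAt_const_rpow (a := c / s) (b := 0) (by positivity)).tendsto.comp
        (tendsto_const_div_atTop_nhds_zero_nat (1 : ℝ))
      simpa [Function.comp_def] using this
    have h₂ := h₁.mul_const s
    rw [one_mul] at h₂
    refine h₂.congr' ?_
    filter_upwards [eventually_ge_atTop 1] with k hk
    obtain ⟨j, rfl⟩ := Nat.exists_eq_add_of_le' hk
    have e : c * s ^ (j + 1 - 1) = c / s * s ^ (j + 1) := by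
      rw [Nat.add_sub_cancel]
      field_simp
      ring
    rw [e, Real.mul_rpow (by positivity) (by positivity), one_div,
      Real.pow_rpow_inv_natCast hs.le (Nat.succ_ne_zero j)]
  refine tendsto_order.mpr ⟨fun r hr => ?_, fun ρ hρ => ?_⟩
  · rcases lt_or_ge r 0 with h0 | h0
    · exact Eventually.of_forall fun k => h0.trans_le (Real.rpow_nonneg (hu k) _)
    · obtain ⟨s, hrs, hsR⟩ := exists_between hr
      have hs : 0 < s := h0.trans_lt hrs
      obtain ⟨c, hc, h⟩ := hlow s hs hsR
      filter_upwards [(key c s hc hs).eventually (lt_mem_nhds hrs), eventually_ge_atTop 1]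
        with k hk hk1
      refine hk.trans_le (Real.rpow_le_rpow (by positivity) ?_ (by positivity))
      simpa [Nat.sub_add_cancel hk1] using h (k - 1)
  · obtain ⟨s, hRs, hsρ⟩ := exists_between hρ
    have hs : 0 < s := hR.trans_lt hRs
    obtain ⟨C, h⟩ := hupp s hRs
    have hC : 0 < max C 1 := lt_max_of_lt_right one_pos
    filter_upwards [(key (max C 1) s hC hs).eventually (gt_mem_nhds hsρ), eventually_ge_atTop 1]
      with k hk hk1
    refine lt_of_le_of_lt (Real.rpow_le_rpow (hu k) ?_ (by positivity)) hk
    have hk' := h (k - 1)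
    rw [Nat.sub_add_cancel hk1] at hk'
    exact hk'.trans (mul_le_mul_of_nonneg_right (le_max_left _ _) (by positivity))

end SpectralRadius

theorem stmt12 (n : ℕ) (hn : 1 ≤ n) (a b : ℝ) (ha : a ≠ 0)
    (hab : a ^ 2 + b ^ 2 ≠ 0) (hab1 : a ≠ b) (hab2 : a ≠ -b)
    (f : (Fin n → ℝ) → ℝ) (hf : Integrable f volume) :
    Tendsto
      (fun k : ℕ =>
        (Real.sqrt ((|3 * a ^ 2 - b ^ 2| + 3 * (a ^ 2 + b ^ 2)) /
            (4 * |a| * (2 * Real.pi) ^ ((n : ℝ) / 2))) *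
          ∫ x, |Hpow n a b f k x|) ^ ((1 : ℝ) / k))
      atTop
      (nhds (⨆ y, |Htransform n a b f y|)) := by
  set A := Real.sqrt ((|3 * a ^ 2 - b ^ 2| + 3 * (a ^ 2 + b ^ 2)) /
    (4 * |a| * (2 * Real.pi) ^ ((n : ℝ) / 2)))
  have hA : 0 < A := by
    have := two_pi_rpow_pos ((n : ℝ) / 2)
    exact Real.sqrt_pos.mpr (by positivity)
  have hD : 0 < (|a| + |b|) * (2 * Real.pi) ^ (-(n : ℝ) / 2) :=
    mul_pos (by positivity) (two_pi_rpow_pos _)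
  set D := (|a| + |b|) * (2 * Real.pi) ^ (-(n : ℝ) / 2)
  refine tendsto_rpow_one_div_of_geometric_bounds
    (fun k => mul_nonneg hA.le (integral_nonneg fun x => abs_nonneg _))
    (fun r hr hrR => ?_) (fun ρ hρ => ?_) (Real.iSup_nonneg fun _ => abs_nonneg _)
  · obtain ⟨y, hy⟩ := exists_lt_of_lt_ciSup hrR
    refine ⟨A * (r / D), by positivity, fun k => ?_⟩
    have h := (pow_le_pow_left₀ hr.le hy.le (k + 1)).trans (abs_Htransform_pow_le ha b hf y k)
    rw [mul_assoc]
    gcongr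
    rw [div_mul_eq_mul_div, div_le_iff₀ hD, ← pow_succ', mul_comm _ D]
    exact h
  · obtain ⟨M, hM⟩ := exists_integral_abs_Hpow_le_of_iSup_lt ha b hf hρ
    refine ⟨A * M, fun k => ?_⟩
    rw [mul_assoc]
    gcongr
    exact hM k
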